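/- arXiv:2501.14156 — 3 statements merged into one kernel-verified Lean document; each statement's English description precedes it below -/
import Mathlib

section
/- Let (W,S) be a Coxeter system with length function ℓ, and let W' ≤ W be a reflection subgroup, i.e. a subgroup generated by a set of reflections of W. Then every left coset wW' (w ∈ W) contains a unique element of minimal length, i.e. there exists a unique u ∈ wW' such that ℓ(u) ≤ ℓ(x) for all x ∈ wW'. -/
namespace CoxeterSystem

variable {B W : Type*} [Group W] {M : CoxeterMatrix B} (cs : CoxeterSystem M W)

open Classical in
/-- The action of the simple reflection `s i` on `W × ℤ/2`: it conjugates the first coordinate and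
flips the second one exactly when the first one is `s i`. -/
noncomputable def simpleSignedConj (i : B) : Function.End (W × ZMod 2) :=
  fun p ↦ (cs.simple i * p.1 * cs.simple i, p.2 + if p.1 = cs.simple i then 1 else 0)

open Classical in
theorem simpleSignedConj_mul_pow_apply (i j : B) (k : ℕ) (t : W) (e : ZMod 2) :
    ((cs.simpleSignedConj i * cs.simpleSignedConj j) ^ k) (t, e) =
      ((cs.simple i * cs.simple j) ^ k * t * ((cs.simple i * cs.simple j) ^ k)⁻¹,
        e + ∑ l ∈ Finset.range (2 * k),
          if t = cs.simple j * (cs.simple i * cs.simple j) ^ l then 1 else 0) := by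
  have hinv : cs.simple j * (cs.simple i * cs.simple j) * (cs.simple j)⁻¹ =
      (cs.simple i * cs.simple j)⁻¹ := by
    simp [mul_assoc]
  have hconj (k : ℕ) : ((cs.simple i * cs.simple j) ^ k)⁻¹ * cs.simple j =
      cs.simple j * (cs.simple i * cs.simple j) ^ k := by
    rw [← inv_pow, ← hinv, conj_pow]
    group
  induction k with
  | zero => simp; rfl
  | succ k ih =>
    rw [pow_succ']
    change (cs.simpleSignedConj i * cs.simpleSignedConj j)
      (((cs.simpleSignedConj i * cs.simpleSignedConj j) ^ k) (t, e)) = _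
    rw [ih]
    change cs.simpleSignedConj i (cs.simpleSignedConj j _) = _
    rw [show 2 * (k + 1) = 2 * k + 1 + 1 by ring, Finset.sum_range_succ, Finset.sum_range_succ]
    set p := cs.simple i * cs.simple j with hp
    have h₁ : p ^ k * t * (p ^ k)⁻¹ = cs.simple j ↔ t = cs.simple j * p ^ (2 * k) := by
      rw [two_mul, pow_add, ← mul_assoc, ← hconj, mul_inv_eq_iff_eq_mul, mul_assoc,
        eq_inv_mul_iff_mul_eq]
    have h₂ : cs.simple j * (p ^ k * t * (p ^ k)⁻¹) * cs.simple j = cs.simple i ↔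
        t = cs.simple j * p ^ (2 * k + 1) := by
      have : cs.simple j * p ^ (2 * k + 1) =
          (p ^ k)⁻¹ * (cs.simple j * cs.simple i * cs.simple j) * p ^ k := by
        rw [show 2 * k + 1 = k + (1 + k) by ring, pow_add, ← mul_assoc, ← hconj, pow_add, pow_one]
        simp only [hp, mul_assoc]
      rw [this]
      constructor
      · intro h
        rw [← h]
        simp [mul_assoc]
      · rintro rfl
        simp [mul_assoc]
    simp only [simpleSignedConj, h₁, h₂]
    refine Prod.ext ?_ ?_
    · simp only [pow_succ', mul_inv_rev, hp, inv_simple, mul_assoc]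
    · simp only [add_assoc]

theorem isLiftable_simpleSignedConj : M.IsLiftable cs.simpleSignedConj := by
  classical
  intro i j
  funext ⟨t, e⟩
  rw [simpleSignedConj_mul_pow_apply, cs.simple_mul_simple_pow, two_mul, Finset.sum_range_add]
  simp only [pow_add, cs.simple_mul_simple_pow, one_mul, CharTwo.add_self_eq_zero]
  simp
  rfl

/-- The action of `W` on `W × ℤ/2` extending `simpleSignedConj`. -/
noncomputable def signedConj : W →* Function.End (W × ZMod 2) :=
  cs.lift ⟨cs.simpleSignedConj, cs.isLiftable_simpleSignedConj⟩

/-- The parity of the number of occurrences of `t` in the right inversion sequence of any word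
representing `w`. -/
noncomputable def inversionParity (w t : W) : ZMod 2 := (cs.signedConj w (t, 0)).2

theorem signedConj_simple (i : B) : cs.signedConj (cs.simple i) = cs.simpleSignedConj i :=
  cs.lift_apply_simple cs.isLiftable_simpleSignedConj i

theorem signedConj_mul_apply (x y : W) (p : W × ZMod 2) :
    cs.signedConj (x * y) p = cs.signedConj x (cs.signedConj y p) := by
  rw [map_mul]
  rfl

theorem signedConj_apply (w t : W) (e : ZMod 2) :
    cs.signedConj w (t, e) = (w * t * w⁻¹, e + cs.inversionParity w t) := by
  unfold inversionParity
  induction w using cs.simple_induction_left generalizing t e with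
  | one =>
    have h (p : W × ZMod 2) : cs.signedConj 1 p = p := by rw [map_one]; rfl
    simp [h]
  | mul_simple_left w i ih =>
    rw [signedConj_mul_apply, signedConj_mul_apply, ih t e, ih t 0, signedConj_simple]
    simp only [simpleSignedConj, mul_inv_rev, inv_simple, mul_assoc, add_assoc, zero_add]

theorem inversionParity_mul (x y t : W) :
    cs.inversionParity (x * y) t =
      cs.inversionParity y t + cs.inversionParity x (y * t * y⁻¹) := by
  conv_lhs => rw [inversionParity, signedConj_mul_apply, signedConj_apply, signedConj_apply]
  simp

theorem inversionParity_one (t : W) : cs.inversionParity 1 t = 0 := by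
  rw [inversionParity, map_one]
  rfl

theorem inversionParity_simple_ne_zero_iff (i : B) (t : W) :
    cs.inversionParity (cs.simple i) t ≠ 0 ↔ t = cs.simple i := by
  simp [inversionParity, signedConj_simple, simpleSignedConj]

theorem length_wordProd_mul_lt_of_inversionParity_ne_zero (ω : List B) (t : W)
    (h : cs.inversionParity (cs.wordProd ω) t ≠ 0) :
    cs.length (cs.wordProd ω * t) < ω.length := by
  induction ω with
  | nil => simp [inversionParity_one] at h
  | cons i ω ih =>
    rw [wordProd_cons, inversionParity_mul] at h
    rw [wordProd_cons, List.length_cons]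
    by_cases h' : cs.inversionParity (cs.wordProd ω) t = 0
    · rw [h', zero_add, inversionParity_simple_ne_zero_iff, mul_inv_eq_iff_eq_mul] at h
      rw [mul_assoc, h, simple_mul_simple_cancel_left]
      exact Nat.lt_succ_of_le (cs.length_wordProd_le ω)
    · have h₁ := cs.length_mul_le (cs.simple i) (cs.wordProd ω * t)
      rw [length_simple, ← mul_assoc] at h₁
      have h₂ := ih h'
      lia

theorem length_mul_lt_of_inversionParity_ne_zero {w t : W} (h : cs.inversionParity w t ≠ 0) :
    cs.length (w * t) < cs.length w := by
  obtain ⟨ω, hω, rfl⟩ := cs.exists_isReduced w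
  rw [hω.eq]
  exact cs.length_wordProd_mul_lt_of_inversionParity_ne_zero ω t h

/-- The canonical generators of a reflection subgroup `H`: the involutions in `H` whose only
inversion in `H` is themselves. -/
def canonicalGenerators (H : Subgroup W) : Set W :=
  {s | s ∈ H ∧ s * s = 1 ∧ ∀ t ∈ H, cs.inversionParity s t ≠ 0 ↔ t = s}

theorem simple_mem_canonicalGenerators {H : Subgroup W} {i : B} (h : cs.simple i ∈ H) :
    cs.simple i ∈ cs.canonicalGenerators H :=
  ⟨h, cs.simple_mul_simple_self i, fun t _ ↦ cs.inversionParity_simple_ne_zero_iff i t⟩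

theorem conj_mem_canonicalGenerators {H : Subgroup W} {i : B} (hi : cs.simple i ∉ H) {s : W}
    (hs : s ∈ cs.canonicalGenerators (H.comap (MulAut.conj (cs.simple i)).toMonoidHom)) :
    cs.simple i * s * (cs.simple i)⁻¹ ∈ cs.canonicalGenerators H := by
  obtain ⟨hsH, hss, hs⟩ := hs
  have hsH' : cs.simple i * s * cs.simple i ∈ H := by simpa using hsH
  refine ⟨by simpa using hsH', by rw [conj_mul, hss]; simp, fun t ht ↦ ?_⟩
  have hzero {u : W} (hu : u ∈ H) : cs.inversionParity (cs.simple i) u = 0 := by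
    by_contra h
    rw [← ne_eq, inversionParity_simple_ne_zero_iff] at h
    exact hi (h ▸ hu)
  have hzero' : cs.inversionParity (cs.simple i)
      (s * (cs.simple i * t * cs.simple i) * s⁻¹) = 0 := by
    by_contra h
    rw [← ne_eq, inversionParity_simple_ne_zero_iff] at h
    have hmem : (cs.simple i * s * cs.simple i) * t * (cs.simple i * s * cs.simple i)⁻¹ ∈ H :=
      H.mul_mem (H.mul_mem hsH' ht) (H.inv_mem hsH')
    have : (cs.simple i * s * cs.simple i) * t * (cs.simple i * s * cs.simple i)⁻¹ =
        cs.simple i * (s * (cs.simple i * t * cs.simple i) * s⁻¹) * cs.simple i := by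
      simp [mul_assoc]
    rw [this, h] at hmem
    exact hi (by simpa using hmem)
  have hmem : cs.simple i * t * cs.simple i ∈
      H.comap (MulAut.conj (cs.simple i)).toMonoidHom := by
    simpa [mul_assoc] using ht
  rw [inv_simple, inversionParity_mul, inversionParity_mul, hzero ht, inv_simple, hzero', zero_add,
    add_zero, hs _ hmem]
  constructor
  · rintro rfl
    simp [mul_assoc]
  · rintro rfl
    simp [mul_assoc]

theorem conj_simple_mem_closure_canonicalGenerators (w : W) (i : B) (H : Subgroup W)
    (h : w * cs.simple i * w⁻¹ ∈ H) :
    w * cs.simple i * w⁻¹ ∈ Subgroup.closure (cs.canonicalGenerators H) := by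
  induction w using cs.simple_induction_left generalizing H with
  | one =>
    simp only [one_mul, inv_one, mul_one] at h ⊢
    exact Subgroup.subset_closure (cs.simple_mem_canonicalGenerators h)
  | mul_simple_left w j ih =>
    have heq : cs.simple j * w * cs.simple i * (cs.simple j * w)⁻¹ =
        cs.simple j * (w * cs.simple i * w⁻¹) * (cs.simple j)⁻¹ := by
      simp only [mul_inv_rev, mul_assoc]
    rw [heq] at h ⊢
    by_cases hj : cs.simple j ∈ H
    · have hgen := Subgroup.subset_closure (cs.simple_mem_canonicalGenerators hj)
      rw [H.mul_mem_cancel_right (H.inv_mem hj), H.mul_mem_cancel_left hj] at h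
      exact mul_mem (mul_mem hgen (ih H h)) (inv_mem hgen)
    · have hmem := ih (H.comap (MulAut.conj (cs.simple j)).toMonoidHom) h
      have hle : Subgroup.closure
          (cs.canonicalGenerators (H.comap (MulAut.conj (cs.simple j)).toMonoidHom)) ≤
          (Subgroup.closure (cs.canonicalGenerators H)).comap
            (MulAut.conj (cs.simple j)).toMonoidHom :=
        (Subgroup.closure_le _).2 fun s hs ↦
          Subgroup.subset_closure (cs.conj_mem_canonicalGenerators hj hs)
      exact hle hmem

theorem exists_list_prod_of_mem_closure {T : Set W} (hT : ∀ t ∈ T, cs.IsReflection t) {x : W}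
    (hx : x ∈ Subgroup.closure T) :
    ∃ L : List W, (∀ s ∈ L, s ∈ cs.canonicalGenerators (Subgroup.closure T)) ∧ L.prod = x := by
  have hle : Subgroup.closure T ≤
      Subgroup.closure (cs.canonicalGenerators (Subgroup.closure T)) := by
    refine (Subgroup.closure_le _).2 fun t ht ↦ ?_
    obtain ⟨w, i, rfl⟩ := hT t ht
    exact cs.conj_simple_mem_closure_canonicalGenerators w i _ (Subgroup.subset_closure ht)
  have hx' := hle hx
  rw [← Subgroup.mem_toSubmonoid, Subgroup.closure_toSubmonoid] at hx'
  obtain ⟨L, hL, rfl⟩ := Submonoid.exists_list_of_mem_closure hx'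
  refine ⟨L, fun s hs ↦ (hL s hs).elim id fun h ↦ ?_, rfl⟩
  have : s⁻¹ = s := by simpa using (inv_eq_of_mul_eq_one_left h.2.1).symm
  rwa [Set.mem_inv, this] at h

/-- Exchange property with respect to the canonical generators. -/
theorem exists_shorter_list_prod {H : Subgroup W} (L : List W)
    (hL : ∀ s ∈ L, s ∈ cs.canonicalGenerators H) {t : W} (ht : t ∈ H)
    (h : cs.inversionParity L.prod t ≠ 0) :
    ∃ L' : List W, (∀ s ∈ L', s ∈ cs.canonicalGenerators H) ∧ L'.length < L.length ∧
      L'.prod = L.prod * t := by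
  induction L with
  | nil => simp [inversionParity_one] at h
  | cons a L ih =>
    simp only [List.forall_mem_cons] at hL
    obtain ⟨ha, hL⟩ := hL
    rw [List.prod_cons, inversionParity_mul] at h
    by_cases h' : cs.inversionParity L.prod t = 0
    · have hmem : L.prod ∈ H := H.list_prod_mem fun s hs ↦ (hL s hs).1
      rw [h', zero_add, ha.2.2 _ (H.mul_mem (H.mul_mem hmem ht) (H.inv_mem hmem)),
        mul_inv_eq_iff_eq_mul] at h
      refine ⟨L, hL, by simp, ?_⟩
      rw [List.prod_cons, mul_assoc, h, ← mul_assoc, ha.2.1, one_mul]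
    · obtain ⟨L', hL', hlen, hprod⟩ := ih hL h'
      exact ⟨a :: L', by simpa using ⟨ha, hL'⟩, by simpa using hlen, by simp [hprod, mul_assoc]⟩

theorem list_prod_eq_one_of_inversionParity_eq_zero {H : Subgroup W} (L : List W)
    (hL : ∀ s ∈ L, s ∈ cs.canonicalGenerators H)
    (h : ∀ t ∈ H, cs.inversionParity L.prod t = 0) : L.prod = 1 := by
  induction hn : L.length using Nat.strong_induction_on generalizing L with
  | _ n ih =>
    rcases L.eq_nil_or_concat with rfl | ⟨L, s, rfl⟩
    · rfl
    · have hs : s ∈ cs.canonicalGenerators H := hL s (by simp)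
      have hL₀ : ∀ a ∈ L, a ∈ cs.canonicalGenerators H := fun a ha ↦ hL a (by simp [ha])
      have hprod : (L.concat s).prod = L.prod * s := by simp
      have hLs : cs.inversionParity L.prod s ≠ 0 := by
        intro h₀
        have h₁ := h s hs.1
        rw [hprod, inversionParity_mul, mul_inv_cancel_right, h₀, add_zero] at h₁
        exact (hs.2.2 s hs.1).2 rfl h₁
      obtain ⟨L', hL', hlen, hL'prod⟩ := cs.exists_shorter_list_prod L hL₀ hs.1 hLs
      rw [hprod, ← hL'prod] at h ⊢
      exact ih L'.length (by simp at hn; lia) L' hL' h rfl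

end CoxeterSystem

/-- Every left coset of a reflection subgroup of a Coxeter group contains a
unique element of minimal length. -/
theorem reflection_subgroup_coset_unique_min_length
    {B W : Type*} [Group W] {M : CoxeterMatrix B} (cs : CoxeterSystem M W)
    (W' : Subgroup W)
    (hrefl : ∃ T : Set W, (∀ t ∈ T, cs.IsReflection t) ∧ W' = Subgroup.closure T)
    (w : W) :
    ∃! u : W, w⁻¹ * u ∈ W' ∧ ∀ x : W, w⁻¹ * x ∈ W' → cs.length u ≤ cs.length x := by
  obtain ⟨T, hT, rfl⟩ := hrefl
  set H := Subgroup.closure T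
  have hzero {u : W} (hu : w⁻¹ * u ∈ H) (hmin : ∀ x, w⁻¹ * x ∈ H → cs.length u ≤ cs.length x)
      {t : W} (ht : t ∈ H) : cs.inversionParity u t = 0 := by
    by_contra h
    refine (cs.length_mul_lt_of_inversionParity_ne_zero h).not_ge (hmin _ ?_)
    rw [← mul_assoc]
    exact H.mul_mem hu ht
  obtain ⟨u, hu, hmin⟩ := exists_minimalFor_of_wellFoundedLT (fun x ↦ w⁻¹ * x ∈ H) cs.length
    ⟨w, by simp⟩
  have humin (x : W) (hx : w⁻¹ * x ∈ H) : cs.length u ≤ cs.length x :=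
    (le_total _ _).elim id (hmin hx)
  refine ⟨u, ⟨hu, humin⟩, fun v ⟨hv, hvmin⟩ ↦ ?_⟩
  have hx : u⁻¹ * v ∈ H := by
    have := H.mul_mem (H.inv_mem hu) hv
    simpa [mul_assoc] using this
  obtain ⟨L, hL, hprod⟩ := cs.exists_list_prod_of_mem_closure hT hx
  have hone := cs.list_prod_eq_one_of_inversionParity_eq_zero L hL fun t ht ↦ by
    rw [hprod]
    have h := cs.inversionParity_mul u (u⁻¹ * v) t
    rw [mul_inv_cancel_left, hzero hv hvmin ht,
      hzero hu humin (H.mul_mem (H.mul_mem hx ht) (H.inv_mem hx)), add_zero] at h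
    exact h.symm
  rw [hprod, inv_mul_eq_one] at hone
  exact hone.symm
end

section
/- Let k be a field of characteristic zero, Λ a finitely generated free abelian group, and R = k[Λ] its group algebra (a Laurent polynomial ring in finitely many variables over k). Let M be a bounded complex of finitely generated free R-modules such that for every maximal ideal 𝔪 ⊂ R the homology of the complex M ⊗_R (R/𝔪) is concentrated in degree 0. Then the homology of M is concentrated in degree 0, and H⁰(M) is a finitely generated free R-module; in other words, M is quasi-isomorphic to a finitely generated free R-module placed in degree 0. -/
/-- Two vectors are in the same orbit of the general linear group. -/
def Matrix.GLEquiv {ι B : Type*} [Fintype ι] [DecidableEq ι] [CommRing B] (v w : ι → B) : Prop :=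
  ∃ M : Matrix ι ι B, IsUnit M.det ∧ M.mulVec v = w

namespace Matrix.GLEquiv

variable {ι κ B S : Type*} [Fintype ι] [DecidableEq ι] [Fintype κ] [DecidableEq κ]
  [CommRing B] [CommRing S]

theorem refl (v : ι → B) : GLEquiv v v := ⟨1, by simp, by simp⟩

theorem trans {u v w : ι → B} (h₁ : GLEquiv u v) (h₂ : GLEquiv v w) : GLEquiv u w := by
  obtain ⟨M, hM, rfl⟩ := h₁
  obtain ⟨N, hN, rfl⟩ := h₂
  exact ⟨N * M, by simpa using ⟨hN, hM⟩, by simp⟩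

theorem symm {v w : ι → B} (h : GLEquiv v w) : GLEquiv w v := by
  obtain ⟨M, hM, rfl⟩ := h
  exact ⟨M⁻¹, by simpa [Matrix.isUnit_nonsing_inv_det_iff] using hM, by
    simp [Matrix.nonsing_inv_mul _ hM]⟩

theorem map {v w : ι → B} (h : GLEquiv v w) (f : B →+* S) : GLEquiv (f ∘ v) (f ∘ w) := by
  obtain ⟨M, hM, rfl⟩ := h
  refine ⟨f.mapMatrix M, by rw [← RingHom.map_det]; exact hM.map f, ?_⟩
  ext i
  simp [RingHom.map_mulVec]

theorem of_ringEquiv (Φ : B ≃+* S) {v : ι → B} {w : ι → S} (h : GLEquiv (Φ ∘ v) w) :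
    GLEquiv v (Φ.symm ∘ w) := by
  have h₁ := h.map (Φ.symm : S →+* B)
  have h₂ : (Φ.symm : S →+* B) ∘ Φ ∘ v = v := by ext; simp
  rwa [h₂] at h₁

theorem of_isUnit_smul (d : ι → B) (hd : ∀ i, IsUnit (d i)) (v : ι → B) :
    GLEquiv v (d * v) :=
  ⟨Matrix.diagonal d, by simpa [Matrix.det_diagonal] using hd, by
    ext i; simp [Matrix.mulVec_diagonal]⟩

theorem reindex (e : ι ≃ κ) {v w : κ → B} (h : GLEquiv (v ∘ e) (w ∘ e)) : GLEquiv v w := by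
  obtain ⟨M, hM, h⟩ := h
  refine ⟨Matrix.reindex e e M, by simpa using hM, ?_⟩
  rw [Matrix.reindex_apply, Matrix.submatrix_mulVec_equiv]
  ext i
  simpa using congrFun h (e.symm i)

/-- Adding a combination of the last entries to the first ones. -/
theorem add_mulVec (v : ι → B) (w : κ → B) (T : Matrix ι κ B) :
    GLEquiv (Sum.elim v w) (Sum.elim (v + T.mulVec w) w) :=
  ⟨Matrix.fromBlocks 1 T 0 1, by simp, by simp [Matrix.fromBlocks_mulVec]⟩

end Matrix.GLEquiv

section Unimodular

open Polynomial Matrix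

section Eval

variable {A κ : Type*} [CommRing A] [IsDomain A] [Fintype κ] [DecidableEq κ]

/-- Evaluations of a row at points congruent modulo a constant lying in the ideal generated by two
of its entries are equivalent. -/
theorem Matrix.GLEquiv.eval_add_of_mem_span (v : Fin 2 ⊕ κ → A[X]) {r : A} (hr : r ≠ 0)
    (h : C r ∈ Ideal.span {v (Sum.inl 0), v (Sum.inl 1)}) (b s : A[X]) :
    GLEquiv (fun i ↦ (v i).eval₂ C b) (fun i ↦ (v i).eval₂ C (b + C r * s)) := by
  obtain ⟨α, β, hαβ⟩ := Ideal.mem_span_pair.mp h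
  have key (p : A[X]) : ∃ D : A[X], p.eval₂ C (b + C r * s) = p.eval₂ C b + C r * D := by
    obtain ⟨D, hD⟩ := (p.map C).evalSubFactor (b + C r * s) b
    simp only [eval_map] at hD
    exact ⟨D * s, by linear_combination hD⟩
  choose D hD using key
  have h₁ := congrArg (eval₂ C b) hαβ
  have h₂ := congrArg (eval₂ C (b + C r * s)) hαβ
  simp only [eval₂_add, eval₂_mul, eval₂_C] at h₁ h₂
  rw [hD, hD, hD, hD] at h₂
  set p := (v (Sum.inl 0)).eval₂ C b
  set q := (v (Sum.inl 1)).eval₂ C b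
  set a := α.eval₂ C b
  set c := β.eval₂ C b
  set P := D (v (Sum.inl 0))
  set Q := D (v (Sum.inl 1))
  let M : Matrix (Fin 2) (Fin 2) A[X] :=
    !![1 + P * a + D β * q, P * c - D β * p; Q * a - D α * q, 1 + Q * c + D α * p]
  let N : Matrix κ (Fin 2) A[X] := Matrix.of fun j ↦ ![D (v (Sum.inr j)) * a, D (v (Sum.inr j)) * c]
  have hM : M.det = 1 := by
    have hC : (C r : A[X]) ≠ 0 := by simpa using hr
    apply mul_left_cancel₀ hC
    simp only [M, Matrix.det_fin_two_of]
    linear_combination h₂ - h₁ + C r * (P * D α + D β * Q) * h₁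
  refine ⟨Matrix.fromBlocks M 0 N 1, by simp [hM], ?_⟩
  rw [Matrix.fromBlocks_mulVec]
  ext1 (i | i)
  · fin_cases i
    · simp [M, dotProduct, Fin.sum_univ_two, hD]
      linear_combination P * h₁
    · simp [M, dotProduct, Fin.sum_univ_two, hD]
      linear_combination Q * h₁
  · simp [N, Matrix.mulVec, dotProduct, Fin.sum_univ_two, hD]
    linear_combination D (v (Sum.inr i)) * h₁

end Eval

/-- Coprimality modulo a maximal ideal persists after inverting a single constant. -/
theorem Polynomial.Monic.exists_C_mem_span {A : Type*} [CommRing A] {f g : A[X]} (hf : f.Monic)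
    (m : Ideal A) [m.IsMaximal]
    (h : IsCoprime (f.map (Ideal.Quotient.mk m)) (g.map (Ideal.Quotient.mk m))) :
    ∃ r ∉ m, C r ∈ Ideal.span {f, g} := by
  set J : Ideal A[X] := Ideal.span {f, g}
  have hfin : Module.Finite A (A[X] ⧸ J) := by
    have := hf.finite_quotient
    have hle : Ideal.span {f} ≤ J := Ideal.span_mono (by simp)
    exact Module.Finite.of_surjective (Ideal.Quotient.factorₐ A hle).toLinearMap
      (Ideal.Quotient.factor_surjective hle)
  obtain ⟨u, w, huw⟩ := h
  obtain ⟨u, rfl⟩ := Polynomial.map_surjective _ Ideal.Quotient.mk_surjective u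
  obtain ⟨w, rfl⟩ := Polynomial.map_surjective _ Ideal.Quotient.mk_surjective w
  have hmem : 1 - (u * f + w * g) ∈ m.map (C : A →+* A[X]) := by
    rw [← Ideal.mk_ker (I := m), ← Polynomial.ker_mapRingHom, RingHom.mem_ker]
    simp [huw]
  have hone : (1 : A[X] ⧸ J) ∈ m.map (algebraMap A (A[X] ⧸ J)) := by
    have h₁ := Ideal.mem_map_of_mem (Ideal.Quotient.mk J) hmem
    rw [Ideal.map_map] at h₁
    have h₂ : Ideal.Quotient.mk J (u * f + w * g) = 0 :=
      Ideal.Quotient.eq_zero_iff_mem.mpr (Ideal.mem_span_pair.mpr ⟨u, w, rfl⟩)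
    rwa [map_sub, h₂, map_one, sub_zero] at h₁
  obtain ⟨r, hr, hr'⟩ := Submodule.exists_sub_one_mem_and_smul_eq_zero_of_fg_of_le_smul m
    (⊤ : Submodule A (A[X] ⧸ J)) Module.Finite.fg_top (by
      rw [Ideal.smul_top_eq_map, (Ideal.eq_top_iff_one _).mpr hone]
      simp)
  refine ⟨r, fun hrm ↦ ?_, ?_⟩
  · exact (Ideal.ne_top_iff_one m).mp (Ideal.IsMaximal.ne_top ‹_›)
      (by simpa using m.sub_mem hrm hr)
  · have h₁ : Ideal.Quotient.mk J (r • (1 : A[X])) = 0 := hr' (Ideal.Quotient.mk J 1) trivial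
    rwa [Ideal.Quotient.eq_zero_iff_mem, smul_eq_C_mul, mul_one] at h₁

/-- If `p ≠ 0`, `a` and `d` have no common factor, then `a + t * d` is coprime to `p`
for some `t`. -/
theorem exists_isCoprime_add_mul {R : Type*} [CommRing R] [IsDomain R] [IsPrincipalIdealRing R]
    {p a d : R} (hp : p ≠ 0) (h : Ideal.span {p, a, d} = ⊤) :
    ∃ t, IsCoprime p (a + t * d) := by
  classical
  let s := (UniqueFactorizationMonoid.factors p).filter (fun q ↦ ¬ q ∣ a)
  refine ⟨s.prod, ?_⟩
  refine isCoprime_of_prime_dvd (fun h ↦ hp h.1) fun q hq hqp hqa ↦ ?_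
  obtain ⟨q', hq', hqq'⟩ := UniqueFactorizationMonoid.exists_mem_factors_of_dvd hp hq.irreducible hqp
  by_cases ha : q ∣ a
  · have hqd : q ∣ d := by
      refine (hq.dvd_or_dvd ((dvd_add_right ha).mp hqa)).resolve_left fun hs ↦ ?_
      obtain ⟨x, hx, hqx⟩ := hq.exists_mem_multiset_dvd hs
      have hx := Multiset.mem_filter.mp hx
      have hxq : Associated q x := hq.associated_of_dvd
        (UniqueFactorizationMonoid.prime_of_factor x hx.1) hqx
      exact hx.2 (hxq.dvd_iff_dvd_left.mp ha)
    have : Ideal.span {p, a, d} ≤ Ideal.span {q} := by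
      rw [Ideal.span_le]
      rintro x (rfl | rfl | rfl) <;> simpa [Ideal.mem_span_singleton]
    rw [h, top_le_iff, Ideal.span_singleton_eq_top] at this
    exact hq.not_isUnit this
  · refine ha ((dvd_add_left (Dvd.dvd.mul_right ?_ d)).mp hqa)
    refine hqq'.dvd.trans (Multiset.dvd_prod (Multiset.mem_filter.mpr ⟨hq', ?_⟩))
    exact fun hh ↦ ha (hqq'.dvd_iff_dvd_left.mpr hh)

/-- A unimodular row of polynomials with a monic entry is equivalent to its value at `0`. -/
theorem Matrix.GLEquiv.eval_zero_of_monic {A κ : Type*} [CommRing A] [IsDomain A] [Fintype κ]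
    [DecidableEq κ] (v : Fin 2 ⊕ κ → A[X]) (hv : Ideal.span (Set.range v) = ⊤)
    (hmonic : (v (Sum.inl 0)).Monic) :
    GLEquiv v (fun i ↦ C ((v i).eval 0)) := by
  let I : Ideal A :=
    { carrier := {r | ∀ b s : A[X],
        GLEquiv (fun i ↦ (v i).eval₂ C b) (fun i ↦ (v i).eval₂ C (b + C r * s))}
      zero_mem' := fun b s ↦ by simpa using refl _
      add_mem' := fun {r r'} h h' b s ↦ by
        have := (h b s).trans (h' _ s)
        rwa [add_assoc, ← add_mul, ← C_add] at this
      smul_mem' := fun c r h b s ↦ by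
        have := h b (C c * s)
        rwa [← mul_assoc, ← C_mul, mul_comm r c] at this }
  have hI : I = ⊤ := by
    by_contra hne
    obtain ⟨m, hm, hIm⟩ := Ideal.exists_le_maximal I hne
    let _ := Ideal.Quotient.field m
    let φ := mapRingHom (Ideal.Quotient.mk m)
    have hφ : Function.Surjective φ := Polynomial.map_surjective _ Ideal.Quotient.mk_surjective
    obtain ⟨d, hd⟩ := IsPrincipalIdealRing.principal
      (Ideal.span (Set.range fun j : κ ↦ φ (v (Sum.inr j))))
    have hd' : d ∈ Ideal.span (Set.range fun j : κ ↦ φ (v (Sum.inr j))) := by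
      rw [hd]; exact Ideal.mem_span_singleton_self d
    obtain ⟨c, hc⟩ := Ideal.mem_span_range_iff_exists_fun.mp hd'
    have hspan : Ideal.span {φ (v (Sum.inl 0)), φ (v (Sum.inl 1)), d} = ⊤ := by
      rw [← top_le_iff, ← Ideal.map_top φ, ← hv, Ideal.map_span, Ideal.span_le]
      rintro _ ⟨_, ⟨i | j, rfl⟩, rfl⟩
      · apply Ideal.subset_span
        fin_cases i <;> simp
      · have : φ (v (Sum.inr j)) ∈ Ideal.span {d} := by
          rw [← Ideal.submodule_span_eq, ← hd]
          exact Ideal.subset_span ⟨j, rfl⟩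
        exact Ideal.span_mono (by simp) this
    obtain ⟨t, ht⟩ := exists_isCoprime_add_mul (hmonic.map (Ideal.Quotient.mk m)).ne_zero hspan
    choose c' hc' using fun j ↦ hφ (c j)
    obtain ⟨t, rfl⟩ := hφ t
    let T : Matrix (Fin 2) κ A[X] := ![0, fun j ↦ t * c' j]
    let w := Sum.elim ((v ∘ Sum.inl) + T.mulVec (v ∘ Sum.inr)) (v ∘ Sum.inr)
    have hw : GLEquiv v w := by
      simpa using add_mulVec (v ∘ Sum.inl) (v ∘ Sum.inr) T
    have hw0 : w (Sum.inl 0) = v (Sum.inl 0) := by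
      simp [w, T, Matrix.mulVec]
    have hw1 : φ (w (Sum.inl 1)) = φ (v (Sum.inl 1)) + φ t * d := by
      simp [w, T, Matrix.mulVec, dotProduct, ← hc, hc', Finset.mul_sum, mul_assoc]
    obtain ⟨r, hrm, hr⟩ := Polynomial.Monic.exists_C_mem_span (f := w (Sum.inl 0))
      (g := w (Sum.inl 1)) (hw0 ▸ hmonic) m (by
        change IsCoprime (φ _) (φ _)
        rw [hw1, hw0]
        exact ht)
    refine hrm (hIm fun b s ↦ ?_)
    have hmap (b : A[X]) : GLEquiv (fun i ↦ (v i).eval₂ C b) (fun i ↦ (w i).eval₂ C b) :=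
      hw.map (eval₂RingHom C b)
    have hr0 : r ≠ 0 := fun h ↦ hrm (h ▸ m.zero_mem)
    exact (hmap b).trans ((eval_add_of_mem_span w hr0 hr b s).trans (hmap _).symm)
  have h1 : (1 : A) ∈ I := hI ▸ trivial
  have := h1 X (-X)
  simpa [eval₂_C_X, eval₂_at_zero, coeff_zero_eq_eval_zero] using this

theorem LaurentPolynomial.coeff_mul_T {A : Type*} [Semiring A] (f : LaurentPolynomial A) (m n : ℤ) :
    (f * T n).coeff m = f.coeff (m - n) := by
  rw [T, AddMonoidAlgebra.coeff_mul_single_eq_coeff_mul (m₂ := m - n), mul_one]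
  intro a _
  exact eq_sub_iff_add_eq.symm

theorem LaurentPolynomial.coeff_toLaurent_natCast {A : Type*} [Semiring A] (p : A[X]) (n : ℕ) :
    (toLaurent p).coeff n = p.coeff n := by
  rw [coeff_toLaurent]
  exact Finsupp.mapDomain_apply Nat.castEmbedding.injective _ _

/-- Unimodularity is invariant under the general linear group. -/
theorem Matrix.GLEquiv.span_range_eq_top {ι B : Type*} [Fintype ι] [DecidableEq ι] [CommRing B]
    {v w : ι → B} (h : GLEquiv v w) (hv : Ideal.span (Set.range v) = ⊤) :
    Ideal.span (Set.range w) = ⊤ := by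
  obtain ⟨M, -, rfl⟩ := h.symm
  rw [← top_le_iff, ← hv, Ideal.span_le]
  rintro _ ⟨i, rfl⟩
  exact Ideal.sum_mem _ fun j _ ↦ Ideal.mul_mem_left _ _ (Ideal.subset_span ⟨j, rfl⟩)

theorem IsUnit.isCoprime_X_of_coeff_zero {A : Type*} [CommRing A] {p : A[X]}
    (h : IsUnit (p.coeff 0)) : IsCoprime X p := by
  obtain ⟨c, hc⟩ := h.exists_left_inv
  refine ⟨-(C c * p.divX), C c, ?_⟩
  have h₁ : C c * C (p.coeff 0) = 1 := by rw [← C_mul, hc, C_1]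
  have h₂ := p.X_mul_divX_add
  linear_combination h₁ - C c * h₂

theorem Matrix.GLEquiv.exists_isUnit_of_laurent_sum {A κ : Type*} [CommRing A] [IsDomain A]
    [Fintype κ] [DecidableEq κ] (v : Fin 2 ⊕ κ → LaurentPolynomial A)
    (hv : Ideal.span (Set.range v) = ⊤) (h0 : v (Sum.inl 0) ≠ 0)
    (hcoeff : ∀ n, (v (Sum.inl 0)).coeff n = 0 ∨ IsUnit ((v (Sum.inl 0)).coeff n)) :
    ∃ w i, GLEquiv v w ∧ IsUnit (w i) := by
  choose N p hp using fun j ↦ LaurentPolynomial.exists_T_pow (v j)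
  set q := p (Sum.inl 0) with hq
  have hq0 : q ≠ 0 := by
    rw [← Polynomial.toLaurent_ne_zero, hp]
    exact fun h ↦ h0 ((LaurentPolynomial.isUnit_T _).mul_left_eq_zero.mp h)
  have hqc (n : ℕ) (hn : q.coeff n ≠ 0) : IsUnit (q.coeff n) := by
    have : q.coeff n = (v (Sum.inl 0)).coeff (n - N (Sum.inl 0)) := by
      rw [← LaurentPolynomial.coeff_mul_T, ← hp, LaurentPolynomial.coeff_toLaurent_natCast]
    rw [this] at hn ⊢
    exact (hcoeff _).resolve_left hn
  obtain ⟨f, hf⟩ : X ^ q.natTrailingDegree ∣ q :=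
    X_pow_dvd_iff.mpr fun d hd ↦ coeff_eq_zero_of_lt_natTrailingDegree hd
  set t := q.natTrailingDegree
  have hfc (n : ℕ) : f.coeff n = q.coeff (n + t) := by rw [hf, mul_comm, coeff_mul_X_pow]
  have hf0 : IsUnit (f.coeff 0) := by
    rw [hfc, zero_add]
    exact hqc _ (by simpa [t] using hq0)
  have hflead : IsUnit f.leadingCoeff := by
    have : f.leadingCoeff ≠ 0 := by
      rw [Ne, leadingCoeff_eq_zero]; rintro rfl; exact hq0 (by simpa using hf)
    rw [leadingCoeff, hfc] at this ⊢
    exact hqc _ this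
  obtain ⟨c, hc⟩ := hflead.exists_left_inv
  have hcu : IsUnit c := .of_mul_eq_one _ hc
  let d : Fin 2 ⊕ κ → LaurentPolynomial A :=
    Function.update (fun j ↦ LaurentPolynomial.T (N j)) (Sum.inl 0)
      (LaurentPolynomial.C c * LaurentPolynomial.T (N (Sum.inl 0) - t))
  let u : Fin 2 ⊕ κ → A[X] := Function.update p (Sum.inl 0) (C c * f)
  have hvu : GLEquiv v (toLaurent ∘ u) := by
    have hd (i) : IsUnit (d i) := by
      rcases eq_or_ne i (Sum.inl 0) with rfl | hi
      · rw [show d (Sum.inl 0) = _ from Function.update_self _ _ _]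
        exact (hcu.map LaurentPolynomial.C).mul (LaurentPolynomial.isUnit_T _)
      · rw [show d i = LaurentPolynomial.T (N i) from Function.update_of_ne hi _ _]
        exact LaurentPolynomial.isUnit_T _
    convert of_isUnit_smul d hd v
    ext1 i
    rcases eq_or_ne i (Sum.inl 0) with rfl | hi
    · have := hp (Sum.inl 0)
      rw [← hq, hf, map_mul, toLaurent_X_pow] at this
      have hT : LaurentPolynomial.T (-t) * LaurentPolynomial.T t = (1 : LaurentPolynomial A) := by
        rw [← LaurentPolynomial.T_add]; simp
      simp only [Function.comp, u, d, Function.update_self, Pi.mul_apply, map_mul, toLaurent_C,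
        sub_eq_add_neg, LaurentPolynomial.T_add]
      linear_combination LaurentPolynomial.C c * LaurentPolynomial.T (-t) * this -
        LaurentPolynomial.C c * toLaurent f * hT
    · simp only [Function.comp, u, d, Pi.mul_apply, Function.update_of_ne hi, hp, mul_comm]
  have hu0 : IsUnit ((u (Sum.inl 0)).coeff 0) := by simpa [u] using hcu.mul hf0
  have hmonic : (u (Sum.inl 0)).Monic := by
    simp only [u, Function.update_self]
    exact monic_C_mul_of_mul_leadingCoeff_eq_one hc
  have huspan : Ideal.span (Set.range u) = ⊤ := by
    have h₁ : (1 : LaurentPolynomial A) ∈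
        (Ideal.span (Set.range u)).map (algebraMap A[X] (LaurentPolynomial A)) := by
      have h₂ := hvu.span_range_eq_top hv
      rw [Ideal.map_span, ← Set.range_comp]
      exact h₂ ▸ trivial
    obtain ⟨⟨x, ⟨_, n, rfl⟩⟩, hx⟩ :=
      (IsLocalization.mem_map_algebraMap_iff (Submonoid.powers (X : A[X])) _).mp h₁
    rw [one_mul] at hx
    have hx' : X ^ n = (x : A[X]) := Polynomial.toLaurent_injective hx
    obtain ⟨a, b, hab⟩ := (hu0.isCoprime_X_of_coeff_zero).pow_left (m := n)
    rw [Ideal.eq_top_iff_one, ← hab]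
    exact Ideal.add_mem _ (Ideal.mul_mem_left _ _ (hx' ▸ x.2))
      (Ideal.mul_mem_left _ _ (Ideal.subset_span ⟨_, rfl⟩))
  refine ⟨_, Sum.inl 0, hvu.trans ((eval_zero_of_monic u huspan hmonic).map toLaurent), ?_⟩
  rw [Function.comp_apply, ← coeff_zero_eq_eval_zero]
  exact (hu0.map C).map toLaurent

theorem Matrix.GLEquiv.exists_isUnit_of_laurent {A : Type*} [CommRing A] [IsDomain A] {n : ℕ}
    (v : Fin n → LaurentPolynomial A) (hv : Ideal.span (Set.range v) = ⊤) {i : Fin n}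
    (h0 : v i ≠ 0) (hcoeff : ∀ n, (v i).coeff n = 0 ∨ IsUnit ((v i).coeff n)) :
    ∃ w j, GLEquiv v w ∧ IsUnit (w j) := by
  rcases Nat.lt_or_ge n 2 with hn | hn
  · refine ⟨v, i, refl v, ?_⟩
    have : Subsingleton (Fin n) := Fin.subsingleton_iff_le_one.mpr (by omega)
    rw [← Ideal.span_singleton_eq_top, ← hv]
    congr 1
    ext x
    exact ⟨fun h ↦ ⟨i, h.symm⟩, by rintro ⟨j, rfl⟩; rw [Subsingleton.elim j i]; rfl⟩
  · obtain ⟨m, rfl⟩ := Nat.exists_eq_add_of_le hn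
    let e : Fin 2 ⊕ Fin m ≃ Fin (2 + m) :=
      finSumFinEquiv.trans (Equiv.swap (finSumFinEquiv (Sum.inl 0)) i)
    have he : e (Sum.inl 0) = i := by simp [e]
    obtain ⟨w, j, hw, hj⟩ := exists_isUnit_of_laurent_sum (v ∘ e)
      (by rw [e.surjective.range_comp, hv]) (by simpa [he] using h0) (by simpa [he] using hcoeff)
    refine ⟨w ∘ e.symm, e j, reindex e ?_, by simpa using hj⟩
    convert hw
    ext1
    simp

theorem exists_injOn_sum_mul_pow {n : ℕ} (S : Finset (Fin n → ℤ)) :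
    ∃ N : ℤ, Set.InjOn (fun x : Fin n → ℤ ↦ ∑ i, x i * N ^ (i : ℕ)) S := by
  let p (z : (Fin n → ℤ) × (Fin n → ℤ)) : ℤ[X] := ∑ i, C (z.1 i - z.2 i) * X ^ (i : ℕ)
  have hp : ∏ z ∈ S.offDiag, p z ≠ 0 := by
    rw [Finset.prod_ne_zero_iff]
    intro z hz h
    refine (Finset.mem_offDiag.mp hz).2.2 (funext fun j ↦ ?_)
    have := congrArg (coeff · (j : ℕ)) h
    simp only [p, finsetSum_coeff, coeff_C_mul_X_pow, Fin.val_inj, coeff_zero] at this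
    simpa [sub_eq_zero] using this
  obtain ⟨N, hN⟩ : ∃ N, (∏ z ∈ S.offDiag, p z).eval N ≠ 0 := by
    by_contra! h
    exact hp (Polynomial.funext fun N ↦ by simpa using h N)
  refine ⟨N, fun x hx y hy hxy ↦ ?_⟩
  by_contra hne
  rw [eval_prod, Finset.prod_ne_zero_iff] at hN
  refine hN (x, y) (by simpa [hne] using ⟨hx, hy⟩) ?_
  simpa [p, eval_finsetSum, sub_mul, sub_eq_zero] using hxy

/-- The shear `x ↦ (∑ i, x i * N ^ i, tail x)`. -/
def powShearEquiv (n : ℕ) (N : ℤ) : (Fin (n + 1) → ℤ) ≃+ ℤ × (Fin n → ℤ) where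
  toFun x := (∑ i, x i * N ^ (i : ℕ), Fin.tail x)
  invFun z := Fin.cons (z.1 - ∑ i : Fin n, z.2 i * N ^ (i + 1 : ℕ)) z.2
  left_inv x := by
    ext i
    refine Fin.cases ?_ (fun i ↦ ?_) i <;> simp [Fin.tail, Fin.sum_univ_succ]
  right_inv z := by
    ext <;> simp [Fin.sum_univ_succ]
  map_add' x y := by
    ext <;> simp [add_mul, Finset.sum_add_distrib, Fin.tail]

theorem AddMonoidAlgebra.isUnit_single {k G : Type*} [Field k] [AddCommGroup G] (g : G) {r : k}
    (hr : r ≠ 0) : IsUnit (single g r) :=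
  .of_mul_eq_one (single (-g) r⁻¹) (by simp [single_mul_single, hr, one_def])

theorem AddMonoidAlgebra.eq_zero_or_isUnit_of_support {k G : Type*} [Field k] [AddCommGroup G]
    (f : AddMonoidAlgebra k G) (hf : (f.coeff.support : Set G).Subsingleton) :
    f = 0 ∨ IsUnit f := by
  rcases hf.eq_empty_or_singleton with h | ⟨g, h⟩
  · left
    ext g
    simpa using Set.eq_empty_iff_forall_notMem.mp h g
  · right
    have h' : f.coeff.support = {g} := by exact_mod_cast h
    obtain ⟨hg, hfg⟩ := Finsupp.support_eq_singleton.mp h'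
    have : f = single g (f.coeff g) := by ext1; exact hfg
    rw [this]
    exact isUnit_single g hg

theorem AddMonoidAlgebra.curryRingEquiv_coeff_coeff {k M N : Type*} [Semiring k] [AddMonoid M]
    [AddMonoid N] (f : AddMonoidAlgebra k (M × N)) (a : M) (b : N) :
    ((curryRingEquiv f).coeff a).coeff b = f.coeff (a, b) := by
  rfl

theorem AddMonoidAlgebra.exists_glEquiv_isUnit_pi {k : Type*} [Field k] (r : ℕ) {n : ℕ}
    (v : Fin n → AddMonoidAlgebra k (Fin r → ℤ)) (hv : Ideal.span (Set.range v) = ⊤) :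
    ∃ w j, GLEquiv v w ∧ IsUnit (w j) := by
  obtain ⟨i, hi⟩ : ∃ i, v i ≠ 0 := by
    by_contra! h
    refine (bot_ne_top (α := Ideal (AddMonoidAlgebra k (Fin r → ℤ)))) ?_
    rw [← hv, eq_comm, Ideal.span_eq_bot]
    rintro _ ⟨i, rfl⟩
    exact h i
  cases r with
  | zero =>
    exact ⟨v, i, .refl v, ((v i).eq_zero_or_isUnit_of_support
      Set.subsingleton_of_subsingleton).resolve_left hi⟩
  | succ r =>
    obtain ⟨N, hN⟩ := exists_injOn_sum_mul_pow (v i).coeff.support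
    let Φ : AddMonoidAlgebra k (Fin (r + 1) → ℤ) ≃+*
        LaurentPolynomial (AddMonoidAlgebra k (Fin r → ℤ)) :=
      (mapDomainRingEquiv k (powShearEquiv r N)).trans curryRingEquiv
    have hΦ (f a b) : ((Φ f).coeff a).coeff b = f.coeff ((powShearEquiv r N).symm (a, b)) := by
      change ((curryRingEquiv (mapDomainRingEquiv k (powShearEquiv r N) f)).coeff a).coeff b = _
      rw [curryRingEquiv_coeff_coeff]
      simp
    obtain ⟨w, j, hw, hj⟩ := GLEquiv.exists_isUnit_of_laurent (Φ ∘ v) (i := i)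
      (by
        rw [Set.range_comp, ← RingEquiv.coe_toRingHom, ← Ideal.map_span, hv, Ideal.map_top])
      (by simpa using hi)
      (fun a ↦ by
        refine eq_zero_or_isUnit_of_support _ fun b hb b' hb' ↦ ?_
        simp only [Function.comp_apply, Finset.mem_coe, Finsupp.mem_support_iff, hΦ] at hb hb'
        have h : (fun z : ℤ × (Fin r → ℤ) ↦ z.1)
            (powShearEquiv r N ((powShearEquiv r N).symm (a, b))) = (fun z : ℤ × (Fin r → ℤ) ↦ z.1)
            (powShearEquiv r N ((powShearEquiv r N).symm (a, b'))) := by simp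
        have := hN (by simpa using hb) (by simpa using hb') h
        simpa using this)
    exact ⟨Φ.symm ∘ w, j, hw.of_ringEquiv Φ, hj.map Φ.symm⟩

/-- Over the group algebra of a finitely generated free abelian group, every unimodular vector can
be moved by the general linear group to one with an invertible entry. -/
theorem AddMonoidAlgebra.exists_glEquiv_isUnit {k Λ : Type*} [Field k] [AddCommGroup Λ]
    [Module.Free ℤ Λ] [Module.Finite ℤ Λ] {n : ℕ} (v : Fin n → AddMonoidAlgebra k Λ)
    (hv : Ideal.span (Set.range v) = ⊤) :
    ∃ w j, GLEquiv v w ∧ IsUnit (w j) := by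
  let Φ : AddMonoidAlgebra k Λ ≃+* AddMonoidAlgebra k (Fin (Module.finrank ℤ Λ) → ℤ) :=
    mapDomainRingEquiv k (Module.finBasis ℤ Λ).equivFun.toAddEquiv
  obtain ⟨w, j, hw, hj⟩ := exists_glEquiv_isUnit_pi _ (Φ ∘ v) (by
    rw [Set.range_comp, ← RingEquiv.coe_toRingHom, ← Ideal.map_span, hv, Ideal.map_top])
  exact ⟨Φ.symm ∘ w, j, hw.of_ringEquiv Φ, hj.map Φ.symm⟩

/-- A commutative ring over which every unimodular vector can be moved by the general linear group
to one with an invertible entry; equivalently, stably free modules are free. -/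
class IsHermiteRing (R : Type*) [CommRing R] : Prop where
  exists_isUnit {n : ℕ} (v : Fin n → R) (hv : Ideal.span (Set.range v) = ⊤) :
    ∃ w j, GLEquiv v w ∧ IsUnit (w j)

instance AddMonoidAlgebra.isHermiteRing {k Λ : Type*} [Field k] [AddCommGroup Λ]
    [Module.Free ℤ Λ] [Module.Finite ℤ Λ] : IsHermiteRing (AddMonoidAlgebra k Λ) :=
  ⟨exists_glEquiv_isUnit⟩

end Unimodular

section Cancel

variable {R P F E : Type*} [CommRing R] [AddCommGroup P] [Module R P]
  [AddCommGroup F] [Module R F] [AddCommGroup E] [Module R E]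

theorem Module.Free.of_prod_self_of_isUnit {ι : Type*} [Finite ι] (e : (P × R) ≃ₗ[R] (ι → R))
    {i : ι} (h : IsUnit (e (0, 1) i)) : Module.Free R P := by
  classical
  obtain ⟨c, hc⟩ := h.exists_left_inv
  let g : P →ₗ[R] ({j // j ≠ i} → R) := LinearMap.pi fun j ↦
    (LinearMap.proj j.1 - (c * e (0, 1) j) • LinearMap.proj i) ∘ₗ e.toLinearMap ∘ₗ
      LinearMap.inl R P R
  have hg (p j) : g p j = e (p, 0) j - c * e (0, 1) j * e (p, 0) i := rfl
  have he (p t j) : e (p, t) j = e (p, 0) j + t * e (0, 1) j := by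
    have : (p, t) = (p, 0) + t • ((0, 1) : P × R) := by ext <;> simp
    rw [this, map_add, map_smul]
    rfl
  have hinj : Function.Injective g := by
    rw [← LinearMap.ker_eq_bot, LinearMap.ker_eq_bot']
    intro p hp
    have : e (p, -(c * e (p, 0) i)) = 0 := by
      ext j
      rw [he]
      by_cases hj : j = i
      · subst hj
        simp only [Pi.zero_apply]
        linear_combination -e (p, 0) j * hc
      · have := congrFun hp ⟨j, hj⟩
        rw [hg] at this
        simp only [Pi.zero_apply] at this ⊢
        linear_combination this
    rw [LinearEquiv.map_eq_zero_iff] at this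
    exact congrArg Prod.fst this
  have hsurj : Function.Surjective g := by
    intro y
    let w : ι → R := fun j ↦ if hj : j ≠ i then y ⟨j, hj⟩ else 0
    refine ⟨(e.symm w).1, ?_⟩
    have hw (j) : w j = e ((e.symm w).1, 0) j + (e.symm w).2 * e (0, 1) j := by
      rw [← he]; simp
    ext j
    have h₁ := hw j
    have h₂ := hw i
    have h₃ : w j = y j := dif_pos j.2
    have h₄ : w i = 0 := dif_neg (by simp)
    rw [hg]
    linear_combination h₃ - h₁ + c * e (0, 1) j * (h₂ - h₄) + (e.symm w).2 * e (0, 1) j * hc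
  exact Module.Free.of_equiv (LinearEquiv.ofBijective g ⟨hinj, hsurj⟩).symm

variable [IsHermiteRing R]

theorem Module.Free.of_prod_self [Module.Free R E] [Module.Finite R E] (e : (P × R) ≃ₗ[R] E) :
    Module.Free R P := by
  nontriviality R using Module.Free.of_subsingleton' R P
  let e' := e.trans (Module.finBasis R E).equivFun
  set v := e' (0, 1) with hv
  have hspan : Ideal.span (Set.range v) = ⊤ := by
    rw [Ideal.eq_top_iff_one]
    have h₁ : (LinearMap.snd R P R ∘ₗ e'.symm.toLinearMap) v = 1 := by simp [hv]
    rw [LinearMap.pi_apply_eq_sum_univ] at h₁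
    rw [← h₁]
    exact Ideal.sum_mem _ fun i _ ↦ Ideal.mul_mem_right _ _ (Ideal.subset_span ⟨i, rfl⟩)
  obtain ⟨w, j, ⟨M, hM, rfl⟩, hj⟩ := IsHermiteRing.exists_isUnit v hspan
  let _ := M.invertibleOfIsUnitDet hM
  exact of_prod_self_of_isUnit (e'.trans (Matrix.toLinearEquiv' M inferInstance)) (i := j) hj

/-- Over a Hermite ring, finite free modules cancel. -/
theorem Module.Free.of_prod [Module.Free R F] [Module.Finite R F] [Module.Free R E]
    [Module.Finite R E] (e : (P × F) ≃ₗ[R] E) : Module.Free R P := by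
  nontriviality R using Module.Free.of_subsingleton' R P
  suffices H : ∀ n : ℕ, Module.Free R (P × (Fin n → R)) → Module.Finite R (P × (Fin n → R)) →
      Module.Free R P by
    let e' := e.symm.trans ((LinearEquiv.refl R P).prodCongr (Module.finBasis R F).equivFun)
    exact H _ (Module.Free.of_equiv e') (Module.Finite.equiv e')
  intro n _ _
  induction n with
  | zero => exact Module.Free.of_equiv (LinearEquiv.prodUnique (R := R) (M₂ := Fin 0 → R))
  | succ n ih =>
    let e : ((P × (Fin n → R)) × R) ≃ₗ[R] (P × (Fin (n + 1) → R)) :=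
      (LinearEquiv.prodAssoc R P (Fin n → R) R).trans ((LinearEquiv.refl R P).prodCongr
        ((LinearEquiv.prodComm R _ _).trans (Fin.consLinearEquiv R (fun _ ↦ R))))
    exact ih (of_prod_self e)
      (Module.Finite.of_surjective (LinearMap.fst R (P × (Fin n → R)) R ∘ₗ e.symm.toLinearMap)
        fun x ↦ ⟨e (x, 0), by simp⟩)

theorem LinearMap.free_ker_of_surjective [Module.Free R F] [Module.Finite R F] [Module.Free R E]
    [Module.Finite R E] (f : E →ₗ[R] F) (hf : Function.Surjective f) :
    Module.Free R (LinearMap.ker f) := by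
  obtain ⟨s, hs⟩ := Module.projective_lifting_property f LinearMap.id hf
  have hs' (y) : f (s y) = y := LinearMap.congr_fun hs y
  let e : (LinearMap.ker f × F) →ₗ[R] E := (LinearMap.ker f).subtype.coprod s
  refine Module.Free.of_prod (LinearEquiv.ofBijective e ⟨?_, fun x ↦ ?_⟩)
  · rw [← LinearMap.ker_eq_bot, LinearMap.ker_eq_bot']
    rintro ⟨x, y⟩ h
    have h₁ : x.1 + s y = 0 := h
    have hy : y = 0 := by simpa [hs'] using congrArg f h₁
    subst hy
    simpa using h₁
  · exact ⟨(⟨x - s (f x), by simp [hs']⟩, f x), by simp [e]⟩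

theorem LinearMap.free_quotient_range_of_leftInverse [Module.Free R F] [Module.Finite R F]
    [Module.Free R E] [Module.Finite R E] (f : F →ₗ[R] E) (g : E →ₗ[R] F)
    (h : g ∘ₗ f = LinearMap.id) : Module.Free R (E ⧸ LinearMap.range f) := by
  have h' (x) : g (f x) = x := LinearMap.congr_fun h x
  have := g.free_ker_of_surjective fun x ↦ ⟨f x, h' x⟩
  have hc : IsCompl (LinearMap.range f) (LinearMap.ker g) := by
    constructor
    · rw [Submodule.disjoint_def]
      rintro _ ⟨x, rfl⟩ hx
      rw [← h' x, LinearMap.mem_ker.mp hx, map_zero]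
    · rw [codisjoint_iff_le_sup]
      intro x _
      refine Submodule.mem_sup.mpr ⟨f (g x), ⟨_, rfl⟩, x - f (g x), ?_, by simp⟩
      simp [h']
  exact Module.Free.of_equiv (Submodule.quotientEquivOfIsCompl _ _ hc).symm

end Cancel

section Fiberwise

variable {R F G H : Type*} [CommRing R] [AddCommGroup F] [Module R F]
  [AddCommGroup G] [Module R G] [AddCommGroup H] [Module R H]

theorem Submodule.eq_top_of_forall_isMaximal_le_sup [Module.Finite R G] (N : Submodule R G)
    (h : ∀ m : Ideal R, m.IsMaximal → N ⊔ m • ⊤ = ⊤) : N = ⊤ := by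
  rw [← Submodule.Quotient.subsingleton_iff, ← Module.annihilator_eq_top_iff (R := R)]
  by_contra hne
  obtain ⟨m, hm, hle⟩ := Ideal.exists_le_maximal _ hne
  obtain ⟨r, hr, hr'⟩ := Submodule.exists_sub_one_mem_and_smul_eq_zero_of_fg_of_le_smul m
    (⊤ : Submodule R (G ⧸ N)) Module.Finite.fg_top (by
      have h₁ := congrArg (Submodule.map N.mkQ) (h m hm)
      rw [Submodule.map_sup, Submodule.mkQ_map_self, bot_sup_eq, Submodule.map_smul'',
        Submodule.map_top, Submodule.range_mkQ] at h₁
      exact h₁.ge)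
  have hrm : r ∈ m := hle (Module.mem_annihilator.mpr fun n ↦ hr' n trivial)
  exact (Ideal.ne_top_iff_one m).mp hm.ne_top (by simpa using m.sub_mem hrm hr)

theorem Module.Dual.mem_smul_top_of_forall_mem [Module.Free R F] [Module.Finite R F] {I : Ideal R}
    {φ : Module.Dual R F} (h : ∀ x, φ x ∈ I) : φ ∈ I • (⊤ : Submodule R (Module.Dual R F)) := by
  classical
  rw [← (Module.Free.chooseBasis R F).sum_dual_apply_smul_coord φ]
  exact Submodule.sum_mem _ fun i _ ↦ Submodule.smul_mem_smul (h _) trivial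

/-- A map of finite free modules which is injective on all fibers at closed points is split
injective. -/
theorem LinearMap.exists_leftInverse_of_forall_isMaximal [Module.Free R F] [Module.Finite R F]
    [Module.Projective R G] (f : F →ₗ[R] G)
    (h : ∀ m : Ideal R, m.IsMaximal → ∀ x, f x ∈ m • (⊤ : Submodule R G) →
      x ∈ m • (⊤ : Submodule R F)) :
    ∃ g : G →ₗ[R] F, g ∘ₗ f = LinearMap.id := by
  have hsurj : LinearMap.range f.dualMap = ⊤ := by
    refine Submodule.eq_top_of_forall_isMaximal_le_sup _ fun m hm ↦ ?_
    rw [eq_top_iff]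
    intro φ _
    let _ := Ideal.Quotient.field m
    have hf : m • (⊤ : Submodule R F) ≤ (m • (⊤ : Submodule R G)).comap f := by
      rw [← Submodule.map_le_iff_le_comap, Submodule.map_smul'']
      exact Submodule.smul_mono le_rfl le_top
    let fbar : (F ⧸ m • (⊤ : Submodule R F)) →ₗ[R ⧸ m] (G ⧸ m • (⊤ : Submodule R G)) :=
      LinearMap.extendScalarsOfSurjective Ideal.Quotient.mk_surjective
        (Submodule.mapQ _ _ f hf)
    have hinj : LinearMap.ker fbar = ⊥ := by
      rw [LinearMap.ker_eq_bot']
      intro x hx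
      obtain ⟨x, rfl⟩ := Submodule.mkQ_surjective _ x
      have hx' : Submodule.Quotient.mk (p := m • (⊤ : Submodule R G)) (f x) = 0 := hx
      rw [Submodule.Quotient.mk_eq_zero] at hx'
      exact (Submodule.Quotient.mk_eq_zero _).mpr (h m hm x hx')
    obtain ⟨l, hl⟩ := fbar.exists_leftInverse_of_injective hinj
    let φbar : (F ⧸ m • (⊤ : Submodule R F)) →ₗ[R] R ⧸ m :=
      Submodule.liftQ _ ((Ideal.Quotient.mkₐ R m).toLinearMap ∘ₗ φ) (by
        rw [Submodule.smul_le]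
        intro r hr x _
        rw [LinearMap.mem_ker, LinearMap.comp_apply, map_smul, smul_eq_mul]
        exact Ideal.Quotient.eq_zero_iff_mem.mpr (Ideal.mul_mem_right _ _ hr))
    obtain ⟨g, hg⟩ := Module.projective_lifting_property (Ideal.Quotient.mkₐ R m).toLinearMap
      (φbar ∘ₗ l.restrictScalars R ∘ₗ (m • (⊤ : Submodule R G)).mkQ) Ideal.Quotient.mk_surjective
    refine Submodule.mem_sup.mpr ⟨f.dualMap g, ⟨g, rfl⟩, φ - f.dualMap g, ?_, by simp⟩
    refine Module.Dual.mem_smul_top_of_forall_mem fun x ↦ ?_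
    have h₁ : Ideal.Quotient.mk m (g (f x)) = φbar (l (Submodule.Quotient.mk (f x))) :=
      LinearMap.congr_fun hg (f x)
    have h₂ : l (Submodule.Quotient.mk (f x)) = Submodule.Quotient.mk x :=
      LinearMap.congr_fun hl (Submodule.Quotient.mk x)
    have h₃ : φbar (Submodule.Quotient.mk x) = Ideal.Quotient.mk m (φ x) := rfl
    rw [h₂, h₃] at h₁
    exact Ideal.Quotient.eq.mp h₁.symm
  let b := Module.Free.chooseBasis R F
  choose g hg using fun i ↦ LinearMap.range_eq_top.mp hsurj (b.coord i)
  have hg' (i x) : g i (f x) = b.repr x i := LinearMap.congr_fun (hg i) x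
  refine ⟨∑ i, (g i).smulRight (b i), ?_⟩
  ext x
  simp [hg', b.sum_repr]

/-- Elementwise exactness in the middle of the fiber of `F → G → H` at `m`. -/
def FiberExact (f : F →ₗ[R] G) (g : G →ₗ[R] H) (m : Ideal R) : Prop :=
  ∀ z, g z ∈ m • (⊤ : Submodule R H) → ∃ y, z - f y ∈ m • (⊤ : Submodule R G)

theorem LinearMap.ker_le_range_of_fiberExact [Module.Finite R G] (f : F →ₗ[R] G) (g : G →ₗ[R] H)
    (hgf : g ∘ₗ f = 0) (ρ : G →ₗ[R] LinearMap.ker g) (hρ : ∀ z : LinearMap.ker g, ρ z = z)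
    (h : ∀ m : Ideal R, m.IsMaximal → FiberExact f g m) :
    LinearMap.ker g ≤ LinearMap.range f := by
  have hρs : Function.Surjective ρ := fun z ↦ ⟨z, hρ z⟩
  have : Module.Finite R (LinearMap.ker g) := Module.Finite.of_surjective ρ hρs
  have hgf' (x) : g (f x) = 0 := LinearMap.congr_fun hgf x
  let f' : F →ₗ[R] LinearMap.ker g := f.codRestrict _ hgf'
  have key : LinearMap.range f' = ⊤ := by
    refine Submodule.eq_top_of_forall_isMaximal_le_sup _ fun m hm ↦ ?_
    rw [eq_top_iff]
    intro z _
    obtain ⟨y, hy⟩ := h m hm z (by simp)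
    refine Submodule.mem_sup.mpr ⟨f' y, ⟨y, rfl⟩, z - f' y, ?_, by simp⟩
    have h₁ := Submodule.mem_map_of_mem (f := ρ) hy
    rw [Submodule.map_smul''] at h₁
    have h₂ : ρ (z - f y) = z - f' y := hρ (z - f' y)
    rw [h₂] at h₁
    exact Submodule.smul_mono le_rfl le_top h₁
  intro z hz
  obtain ⟨y, hy⟩ := LinearMap.range_eq_top.mp key ⟨z, hz⟩
  exact ⟨y, congrArg Subtype.val hy⟩

variable {K : Type*} [AddCommGroup K] [Module R K]

theorem LinearMap.exists_retraction_ker_of_exact (g : G →ₗ[R] H) (h : H →ₗ[R] K) (hhg : h ∘ₗ g = 0)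
    (hex : LinearMap.ker h ≤ LinearMap.range g) [Module.Free R (LinearMap.ker h)] :
    ∃ ρ : G →ₗ[R] LinearMap.ker g, ∀ z : LinearMap.ker g, ρ z = z := by
  let g' : G →ₗ[R] LinearMap.ker h := g.codRestrict _ (LinearMap.congr_fun hhg)
  have hg' : Function.Surjective g' := fun z ↦ by
    obtain ⟨y, hy⟩ := hex z.2
    exact ⟨y, Subtype.ext hy⟩
  obtain ⟨s, hs⟩ := Module.projective_lifting_property g' LinearMap.id hg'
  have hs' (y) : g (s y) = y := congrArg Subtype.val (LinearMap.congr_fun hs y)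
  have hmem (x) : (LinearMap.id - s ∘ₗ g' : G →ₗ[R] G) x ∈ LinearMap.ker g := by
    simp only [LinearMap.mem_ker, LinearMap.sub_apply, map_sub, LinearMap.comp_apply, hs']
    exact sub_self _
  refine ⟨(LinearMap.id - s ∘ₗ g').codRestrict _ hmem, fun z ↦ Subtype.ext ?_⟩
  have : g' z = 0 := Subtype.ext z.2
  simp [this]

theorem LinearMap.free_ker_of_exact [IsHermiteRing R] [Module.Free R G] [Module.Finite R G]
    (g : G →ₗ[R] H) (h : H →ₗ[R] K) (hhg : h ∘ₗ g = 0)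
    (hex : LinearMap.ker h ≤ LinearMap.range g) [Module.Free R (LinearMap.ker h)] :
    Module.Free R (LinearMap.ker g) := by
  let g' : G →ₗ[R] LinearMap.ker h := g.codRestrict _ (LinearMap.congr_fun hhg)
  have hg' : Function.Surjective g' := fun z ↦ by
    obtain ⟨y, hy⟩ := hex z.2
    exact ⟨y, Subtype.ext hy⟩
  have : Module.Finite R (LinearMap.ker h) := Module.Finite.of_surjective g' hg'
  have := g'.free_ker_of_surjective hg'
  rwa [show LinearMap.ker g' = LinearMap.ker g from LinearMap.ker_codRestrict _ _ _] at this

/-- The map from the cokernel of `f` induced by `g`. -/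
abbrev LinearMap.cokerDesc (f : F →ₗ[R] G) (g : G →ₗ[R] H) (hgf : g ∘ₗ f = 0) :
    (G ⧸ LinearMap.range f) →ₗ[R] H :=
  (LinearMap.range f).liftQ g (LinearMap.range_le_ker_iff.mpr hgf)

theorem LinearMap.exists_leftInverse_cokerDesc [Module.Finite R G] [Module.Projective R H]
    (f : F →ₗ[R] G) (g : G →ₗ[R] H) (hgf : g ∘ₗ f = 0) [Module.Free R (G ⧸ LinearMap.range f)]
    (h : ∀ m : Ideal R, m.IsMaximal → FiberExact f g m) :
    ∃ l : H →ₗ[R] (G ⧸ LinearMap.range f), l ∘ₗ cokerDesc f g hgf = LinearMap.id := by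
  refine LinearMap.exists_leftInverse_of_forall_isMaximal _ fun m hm x hx ↦ ?_
  obtain ⟨x, rfl⟩ := Submodule.mkQ_surjective _ x
  obtain ⟨y, hy⟩ := h m hm x hx
  have h₁ := Submodule.mem_map_of_mem (f := (LinearMap.range f).mkQ) hy
  have h₂ : (LinearMap.range f).mkQ (f y) = 0 := by simp
  rw [Submodule.map_smul'', map_sub, h₂, sub_zero] at h₁
  exact Submodule.smul_mono le_rfl le_top h₁

theorem LinearMap.ker_le_range_of_leftInverse_cokerDesc (f : F →ₗ[R] G) (g : G →ₗ[R] H)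
    (hgf : g ∘ₗ f = 0) (l : H →ₗ[R] (G ⧸ LinearMap.range f))
    (hl : l ∘ₗ cokerDesc f g hgf = LinearMap.id) : LinearMap.ker g ≤ LinearMap.range f := by
  intro x hx
  have h₁ := LinearMap.congr_fun hl ((LinearMap.range f).mkQ x)
  have h₂ : cokerDesc f g hgf ((LinearMap.range f).mkQ x) = 0 := hx
  rw [LinearMap.comp_apply, h₂, map_zero] at h₁
  exact (Submodule.Quotient.mk_eq_zero _).mp h₁.symm

theorem LinearMap.range_cokerDesc (f : F →ₗ[R] G) (g : G →ₗ[R] H) (hgf : g ∘ₗ f = 0) :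
    LinearMap.range (cokerDesc f g hgf) = LinearMap.range g :=
  Submodule.range_liftQ _ _ _

end Fiberwise

open scoped TensorProduct in
theorem TensorProduct.tmul_one_eq_zero_iff {R G : Type*} [CommRing R] [AddCommGroup G] [Module R G]
    (m : Ideal R) (z : G) :
    z ⊗ₜ[R] (1 : R ⧸ m) = 0 ↔ z ∈ m • (⊤ : Submodule R G) := by
  rw [← (TensorProduct.tensorQuotEquivQuotSMul G m).map_eq_zero_iff,
    ← Submodule.Quotient.mk_eq_zero, ← map_one (Ideal.Quotient.mk m),
    TensorProduct.tensorQuotEquivQuotSMul_tmul_mk, one_smul]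

open scoped TensorProduct in
theorem TensorProduct.exists_tmul_one_eq {R G : Type*} [CommRing R] [AddCommGroup G] [Module R G]
    (m : Ideal R) (w : TensorProduct R G (R ⧸ m)) : ∃ y : G, y ⊗ₜ[R] (1 : R ⧸ m) = w := by
  obtain ⟨y, hy⟩ := Submodule.mkQ_surjective _ (TensorProduct.tensorQuotEquivQuotSMul G m w)
  refine ⟨y, (TensorProduct.tensorQuotEquivQuotSMul G m).injective ?_⟩
  rw [← hy, ← map_one (Ideal.Quotient.mk m), TensorProduct.tensorQuotEquivQuotSMul_tmul_mk,
    one_smul]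
  rfl

open CategoryTheory CategoryTheory.Limits CategoryTheory.MonoidalCategory

namespace CochainComplex

section

variable {R : Type} [CommRing R]

theorem exactAt_iff_ker_le_range (M : CochainComplex (ModuleCat R) ℤ) {i j l : ℤ}
    (hi : i + 1 = j) (hl : j + 1 = l) :
    M.ExactAt j ↔ LinearMap.ker (M.d j l).hom ≤ LinearMap.range (M.d i j).hom := by
  rw [M.exactAt_iff' i j l (by simp [← hi]) (by simp [← hl]),
    ShortComplex.moduleCat_exact_iff_ker_sub_range]
  rfl

theorem d_hom_comp_d_hom (M : CochainComplex (ModuleCat R) ℤ) (i j l : ℤ) :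
    (M.d j l).hom ∘ₗ (M.d i j).hom = 0 := by
  rw [← ModuleCat.hom_comp, M.d_comp_d, ModuleCat.hom_zero]

theorem fiberExact_of_isZero_homology (M : CochainComplex (ModuleCat R) ℤ) (m : Ideal R)
    {i j l : ℤ} (hi : i + 1 = j) (hl : j + 1 = l)
    (h : IsZero ((((tensorRight (ModuleCat.of R (R ⧸ m))).mapHomologicalComplex
      (ComplexShape.up ℤ)).obj M).homology j)) :
    FiberExact (M.d i j).hom (M.d j l).hom m := by
  rw [← HomologicalComplex.exactAt_iff_isZero_homology, exactAt_iff_ker_le_range _ hi hl] at h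
  intro z hz
  obtain ⟨w, hw⟩ := h (x := (z ⊗ₜ[R] (1 : R ⧸ m) :))
    ((TensorProduct.tmul_one_eq_zero_iff m ((M.d j l).hom z)).mpr hz)
  obtain ⟨y, rfl⟩ := TensorProduct.exists_tmul_one_eq m w
  refine ⟨y, (TensorProduct.tmul_one_eq_zero_iff m _).mp ?_⟩
  rw [TensorProduct.sub_tmul, sub_eq_zero]
  exact hw.symm

end

variable {R : Type} [CommRing R] [IsHermiteRing R] (M : CochainComplex (ModuleCat R) ℤ)
  [∀ n, Module.Free R (M.X n)] [∀ n, Module.Finite R (M.X n)]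

theorem ker_le_range_and_free_ker_of_fiberExact
    (hbdd : ∃ b : ℤ, ∀ n, b < n → IsZero (M.X n)) {a : ℤ}
    (h : ∀ m : Ideal R, m.IsMaximal → ∀ i j l : ℤ, i + 1 = j → j + 1 = l → a ≤ j →
      FiberExact (M.d i j).hom (M.d j l).hom m) {j l : ℤ} (hl : j + 1 = l) (hj : a ≤ j) :
    (∀ i, i + 1 = j → LinearMap.ker (M.d j l).hom ≤ LinearMap.range (M.d i j).hom) ∧
      Module.Free R (LinearMap.ker (M.d j l).hom) := by
  obtain ⟨b, hb⟩ := hbdd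
  obtain ⟨t, ht⟩ : ∃ t : ℕ, b < j + t := ⟨(b + 1 - j).toNat, by omega⟩
  induction t generalizing j l with
  | zero =>
    have := ModuleCat.subsingleton_of_isZero (hb j (by simpa using ht))
    exact ⟨fun i _ x _ ↦ by rw [Subsingleton.elim x 0]; exact zero_mem _,
      Module.Free.of_subsingleton _ _⟩
  | succ t ih =>
    obtain ⟨hex, hfree⟩ := ih (j := l) (l := l + 1) rfl (by omega) (by push_cast at ht; omega)
    have hex := hex j hl
    have hd := d_hom_comp_d_hom M j l (l + 1)
    obtain ⟨ρ, hρ⟩ := LinearMap.exists_retraction_ker_of_exact _ _ hd hex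
    exact ⟨fun i hi ↦ LinearMap.ker_le_range_of_fiberExact _ _ (d_hom_comp_d_hom M i j l) ρ hρ
      fun m hm ↦ h m hm i j l hi hl hj, LinearMap.free_ker_of_exact _ _ hd hex⟩

theorem free_coker_of_fiberExact (hbdd : ∃ a : ℤ, ∀ n, n < a → IsZero (M.X n)) {b : ℤ}
    (h : ∀ m : Ideal R, m.IsMaximal → ∀ i j l : ℤ, i + 1 = j → j + 1 = l → j ≤ b →
      FiberExact (M.d i j).hom (M.d j l).hom m) {i j : ℤ} (hi : i + 1 = j) (hj : j ≤ b + 1) :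
    Module.Free R (M.X j ⧸ LinearMap.range (M.d i j).hom) := by
  obtain ⟨a, ha⟩ := hbdd
  obtain ⟨t, ht⟩ : ∃ t : ℕ, j < a + t := ⟨(j + 1 - a).toNat, by omega⟩
  induction t generalizing i j with
  | zero =>
    have := ModuleCat.subsingleton_of_isZero (ha j (by simpa using ht))
    exact Module.Free.of_subsingleton _ _
  | succ t ih =>
    have := ih (i := i - 1) (j := i) (by omega) (by omega) (by push_cast at ht; omega)
    have hd := d_hom_comp_d_hom M (i - 1) i j
    obtain ⟨l, hl⟩ := LinearMap.exists_leftInverse_cokerDesc _ _ hd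
      fun m hm ↦ h m hm (i - 1) i j (by omega) hi (by omega)
    have := LinearMap.free_quotient_range_of_leftInverse _ l hl
    rwa [LinearMap.range_cokerDesc] at this

/-- A bounded complex of finite free modules over a Hermite ring whose fibers at all closed points
have homology concentrated in degree `0` has finite free homology concentrated in degree `0`. -/
theorem homology_of_fiberExact (hbdd : ∃ a b : ℤ, ∀ n : ℤ, (n < a ∨ b < n) → IsZero (M.X n))
    (h : ∀ m : Ideal R, m.IsMaximal → ∀ i j l : ℤ, i + 1 = j → j + 1 = l → j ≠ 0 →
      FiberExact (M.d i j).hom (M.d j l).hom m) :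
    (∀ n : ℤ, n ≠ 0 → IsZero (M.homology n)) ∧ Module.Free R (M.homology 0) ∧
      Module.Finite R (M.homology 0) := by
  obtain ⟨a, b, hab⟩ := hbdd
  have hpos {j l : ℤ} := ker_le_range_and_free_ker_of_fiberExact M (a := 1) (j := j) (l := l)
    ⟨b, fun n hn ↦ hab n (.inr hn)⟩ fun m hm i j l hi hl hj ↦ h m hm i j l hi hl (by omega)
  have hneg {i j l : ℤ} (hi : i + 1 = j) (hl : j + 1 = l) (hj : j < 0) := by
    have := free_coker_of_fiberExact M (b := -1) (i := i) (j := j)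
      ⟨a, fun n hn ↦ hab n (.inl hn)⟩ (fun m hm i j l hi hl hj ↦ h m hm i j l hi hl (by omega))
      hi (by omega)
    exact LinearMap.exists_leftInverse_cokerDesc _ _ (d_hom_comp_d_hom M i j l)
      fun m hm ↦ h m hm i j l hi hl hj.ne
  refine ⟨fun n hn ↦ ?_, ?_⟩
  · rw [← HomologicalComplex.exactAt_iff_isZero_homology,
      exactAt_iff_ker_le_range M (sub_add_cancel n 1) rfl]
    rcases hn.lt_or_gt with hn | hn
    · obtain ⟨l, hl⟩ := hneg (sub_add_cancel n 1) rfl hn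
      exact LinearMap.ker_le_range_of_leftInverse_cokerDesc _ _ _ l hl
    · exact (hpos rfl hn).1 _ (sub_add_cancel n 1)
  · obtain ⟨hex, _⟩ := hpos (j := 1) rfl le_rfl
    have hd := d_hom_comp_d_hom M 0 1 (1 + 1)
    obtain ⟨ρ, hρ⟩ := LinearMap.exists_retraction_ker_of_exact _ _ hd (hex 0 (zero_add 1))
    have : Module.Finite R (LinearMap.ker (M.d 0 1).hom) :=
      Module.Finite.of_surjective ρ fun z ↦ ⟨z, hρ z⟩
    have := LinearMap.free_ker_of_exact _ _ hd (hex 0 (zero_add 1))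
    have hd' := d_hom_comp_d_hom M (-2) (-1) 0
    obtain ⟨l, hl⟩ := hneg (i := -2) (j := -1) (l := 0) rfl rfl (by omega)
    have := free_coker_of_fiberExact M (b := -1) (i := -2) (j := -1)
      ⟨a, fun n hn ↦ hab n (.inl hn)⟩ (fun m hm i j l hi hl hj ↦ h m hm i j l hi hl (by omega))
      rfl (by omega)
    let S := M.sc' (-1) 0 1
    let e : M.homology 0 ≃ₗ[R] (LinearMap.ker S.g.hom ⧸ LinearMap.range S.moduleCatToCycles) :=
      ((ShortComplex.homologyMapIso (M.isoSc' (-1) 0 1 (by simp) (by simp))) ≪≫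
        S.moduleCatHomologyIso).toLinearEquiv
    let f := LinearMap.cokerDesc _ _ hd'
    have hf (x) : f x ∈ LinearMap.ker (M.d 0 1).hom := by
      obtain ⟨x, rfl⟩ := Submodule.mkQ_surjective _ x
      exact LinearMap.congr_fun (d_hom_comp_d_hom M (-1) 0 1) x
    let f' := f.codRestrict _ hf
    have := f'.free_quotient_range_of_leftInverse (l ∘ₗ Submodule.subtype _) hl
    have hrange : LinearMap.range S.moduleCatToCycles = LinearMap.range f' := by
      ext z
      constructor
      · rintro ⟨y, rfl⟩
        exact ⟨Submodule.Quotient.mk y, rfl⟩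
      · rintro ⟨y, rfl⟩
        obtain ⟨y, rfl⟩ := Submodule.mkQ_surjective _ y
        exact ⟨y, rfl⟩
    let e' : M.homology 0 ≃ₗ[R] (LinearMap.ker (M.d 0 1).hom ⧸ LinearMap.range f') :=
      e.trans (Submodule.quotEquivOfEq _ _ hrange)
    exact ⟨Module.Free.of_equiv e'.symm, Module.Finite.equiv e'.symm⟩

end CochainComplex

/-- Let `k` be a field of characteristic zero, `Λ` a finitely generated free
abelian group and `R = k[Λ]` its group algebra.  If `M` is a bounded complex of
finitely generated free `R`-modules all of whose fibers `M ⊗_R R/𝔪` at maximal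
ideals `𝔪` have homology concentrated in degree `0`, then the homology of `M`
is concentrated in degree `0` and `H⁰(M)` is a finitely generated free
`R`-module. -/
theorem perfect_complex_fiberwise_degree_zero
    (k : Type) [Field k] [CharZero k]
    (Λ : Type) [AddCommGroup Λ] [Module.Free ℤ Λ] [Module.Finite ℤ Λ]
    (M : CochainComplex (ModuleCat (AddMonoidAlgebra k Λ)) ℤ)
    (hfree : ∀ n : ℤ, Module.Free (AddMonoidAlgebra k Λ) (M.X n))
    (hfin : ∀ n : ℤ, Module.Finite (AddMonoidAlgebra k Λ) (M.X n))
    (hbdd : ∃ a b : ℤ, ∀ n : ℤ, (n < a ∨ b < n) → IsZero (M.X n))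
    (hfiber : ∀ 𝔪 : Ideal (AddMonoidAlgebra k Λ), 𝔪.IsMaximal → ∀ n : ℤ, n ≠ 0 →
      IsZero ((((tensorRight (ModuleCat.of (AddMonoidAlgebra k Λ)
        (AddMonoidAlgebra k Λ ⧸ 𝔪))).mapHomologicalComplex
        (ComplexShape.up ℤ)).obj M).homology n)) :
    (∀ n : ℤ, n ≠ 0 → IsZero (M.homology n)) ∧
      Module.Free (AddMonoidAlgebra k Λ) (M.homology 0) ∧
      Module.Finite (AddMonoidAlgebra k Λ) (M.homology 0) := by
  exact M.homology_of_fiberExact hbdd fun m hm _ j _ hi hl hj ↦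
    CochainComplex.fiberExact_of_isZero_homology M m hi hl (hfiber m hm j hj)
end

section
/- Let (A, 𝔪) be a commutative Noetherian local ring with residue field κ = A/𝔪, and let C be a bounded complex of finitely generated free A-modules such that the homology of C ⊗_A κ is concentrated in degree 0. Then the homology of C is concentrated in degree 0 and H⁰(C) is a finitely generated free A-module; in other words, C is quasi-isomorphic to a finitely generated free A-module placed in degree 0. -/
open CategoryTheory CategoryTheory.Limits CategoryTheory.MonoidalCategory

namespace LinearMap

section Ring

variable {R X Y Z : Type*} [Ring R] [AddCommGroup X] [AddCommGroup Y] [AddCommGroup Z]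
  [Module R X] [Module R Y] [Module R Z]

/-- A linear map is regular if it has a generalized inverse; this means that its kernel and its
range are both direct summands. -/
def IsRegular (f : X →ₗ[R] Y) : Prop :=
  ∃ s : Y →ₗ[R] X, f ∘ₗ s ∘ₗ f = f

theorem isRegular_of_subsingleton_left [Subsingleton X] (f : X →ₗ[R] Y) : f.IsRegular :=
  ⟨0, Subsingleton.elim _ _⟩

theorem isRegular_of_subsingleton_right [Subsingleton Y] (f : X →ₗ[R] Y) : f.IsRegular :=
  ⟨0, Subsingleton.elim _ _⟩

/-- The homology in the middle of two composable regular maps is a direct summand of the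
middle term. -/
theorem IsRegular.projective_ker_quotient {f : X →ₗ[R] Y} {g : Y →ₗ[R] Z} [Module.Projective R Y]
    (hf : f.IsRegular) (hg : g.IsRegular) (h : ∀ x, f x ∈ ker g) :
    Module.Projective R (ker g ⧸ range (f.codRestrict (ker g) h)) := by
  obtain ⟨s, hs⟩ := hf
  obtain ⟨t, ht⟩ := hg
  have hs' (x : X) : f (s (f x)) = f x := LinearMap.congr_fun hs x
  have ht' (y : Y) : g (t (g y)) = g y := LinearMap.congr_fun ht y
  let p : Y →ₗ[R] ker g := (id - t ∘ₗ g).codRestrict _ fun y ↦ by simp [ht']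
  let i : (ker g ⧸ range (f.codRestrict (ker g) h)) →ₗ[R] Y :=
    Submodule.liftQ _ ((id - f ∘ₗ s) ∘ₗ (ker g).subtype) <| by
      rintro _ ⟨x, rfl⟩
      simp [hs']
  refine Module.Projective.of_split i (Submodule.mkQ _ ∘ₗ p) ?_
  refine Submodule.linearMap_qext _ (LinearMap.ext fun z ↦ ?_)
  refine (Submodule.Quotient.eq _).2 ⟨-s z, Subtype.ext ?_⟩
  have hz : g z = 0 := z.2
  have hfz : g (f (s z)) = 0 := h _
  have hi : i ((Submodule.mkQ _) z) = z - f (s z) := rfl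
  simp only [hi]
  simp [p, hz, hfz]

theorem IsRegular.of_exact_right {f : X →ₗ[R] Y} {g : Y →ₗ[R] Z} [Module.Projective R Y]
    (hg : g.IsRegular) (h : Function.Exact f g) : f.IsRegular := by
  obtain ⟨s, hs⟩ := hg
  have hs' (y : Y) : g (s (g y)) = g y := LinearMap.congr_fun hs y
  let p : Y →ₗ[R] range f := (id - s ∘ₗ g).codRestrict _ fun y ↦ (h _).1 (by simp [hs'])
  obtain ⟨t, ht⟩ := Module.projective_lifting_property f.rangeRestrict p f.surjective_rangeRestrict
  refine ⟨t, LinearMap.ext fun x ↦ ?_⟩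
  have hx : f (t (f x)) = f x - s (g (f x)) := congr_arg Subtype.val (LinearMap.congr_fun ht (f x))
  simpa [h.apply_apply_eq_zero] using hx

end Ring

section Local

open IsLocalRing

variable {R X Y Z : Type*} [CommRing R] [IsLocalRing R]
  [AddCommGroup X] [AddCommGroup Y] [AddCommGroup Z] [Module R X] [Module R Y] [Module R Z]
  {f : X →ₗ[R] Y} {g : Y →ₗ[R] Z}

theorem IsRegular.exact_of_exact_lTensor_residueField [Module.Finite R Y] (hg : g.IsRegular)
    (hgf : g ∘ₗ f = 0)
    (h : Function.Exact (f.lTensor (ResidueField R)) (g.lTensor (ResidueField R))) :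
    Function.Exact f g := by
  obtain ⟨s, hs⟩ := hg
  have hs' (y : Y) : g (s (g y)) = g y := LinearMap.congr_fun hs y
  let p : Y →ₗ[R] Y := id - s ∘ₗ g
  have hp : range p = ker g := by
    refine le_antisymm ?_ fun y hy ↦ ⟨y, by simp [p, mem_ker.1 hy]⟩
    rintro _ ⟨y, rfl⟩
    simp [p, hs']
  have hfg : (ker g).FG := by
    rw [← hp, range_eq_map]
    exact Module.Finite.fg_top.map p
  refine LinearMap.exact_iff.2 (le_antisymm ?_ (range_le_ker_iff.2 hgf))
  refine Submodule.le_of_le_smul_of_le_jacobson_bot hfg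
    (IsLocalRing.maximalIdeal_le_jacobson ⊥) fun y hy ↦ ?_
  obtain ⟨w, hw⟩ := (h ((1 : ResidueField R) ⊗ₜ[R] y)).1 (by simp [mem_ker.1 hy])
  obtain ⟨x, rfl⟩ :=
    TensorProduct.mk_surjective R X (ResidueField R) residue_surjective w
  have hm : y - f x ∈ IsLocalRing.maximalIdeal R • (⊤ : Submodule R Y) := by
    rw [← LinearMap.ker_tensorProductMk, mem_ker, map_sub, sub_eq_zero]
    exact hw.symm
  have hpm := Submodule.mem_map_of_mem (f := p) hm
  rw [Submodule.map_smul'', ← range_eq_map, hp] at hpm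
  have hgfx : g (f x) = 0 := LinearMap.congr_fun hgf x
  have hpy : p (y - f x) = y - f x := by simp [p, mem_ker.1 hy, hgfx]
  rw [hpy] at hpm
  exact Submodule.mem_sup.2 ⟨f x, ⟨x, rfl⟩, _, hpm, by abel⟩

theorem IsRegular.exact_and_isRegular_right [Module.Finite R Y] [Module.Finite R Z]
    [Module.Free R Z] (hf : f.IsRegular) (hgf : g ∘ₗ f = 0)
    (h : Function.Exact (f.lTensor (ResidueField R)) (g.lTensor (ResidueField R))) :
    Function.Exact f g ∧ g.IsRegular := by
  obtain ⟨s, hs⟩ := hf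
  have hs' (x : X) : f (s (f x)) = f x := LinearMap.congr_fun hs x
  let q : (Y ⧸ range f) →ₗ[R] Z := (range f).liftQ g (range_le_ker_iff.2 hgf)
  let i : (Y ⧸ range f) →ₗ[R] Y := (range f).liftQ (id - f ∘ₗ s) <| by
    rintro _ ⟨x, rfl⟩
    simp [hs']
  have hq : q ∘ₗ (range f).mkQ = g := Submodule.liftQ_mkQ _ _ _
  have hinj : Function.Injective (q.lTensor (ResidueField R)) := by
    rw [← ker_eq_bot, eq_bot_iff]
    intro w hw
    obtain ⟨v, rfl⟩ := lTensor_surjective (ResidueField R) (range f).mkQ_surjective w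
    obtain ⟨u, rfl⟩ := (h v).1 <| by rw [← hq, lTensor_comp]; exact hw
    have h0 : (range f).mkQ ∘ₗ f = 0 := range_mkQ_comp f
    have := LinearMap.congr_fun (lTensor_comp (ResidueField R) (range f).mkQ f) u
    rw [h0] at this
    simpa using this.symm
  obtain ⟨r, hr⟩ := (IsLocalRing.split_injective_iff_lTensor_residueField_injective q).2 hinj
  have hr' (y : Y) : r (g y) = (range f).mkQ y := LinearMap.congr_fun hr ((range f).mkQ y)
  refine ⟨LinearMap.exact_iff.2 (le_antisymm (fun y hy ↦ ?_) (range_le_ker_iff.2 hgf)),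
    i ∘ₗ r, LinearMap.ext fun y ↦ ?_⟩
  · rw [← Submodule.ker_mkQ (range f), mem_ker, ← hr', mem_ker.1 hy, map_zero]
  · have hgf' (x : X) : g (f x) = 0 := LinearMap.congr_fun hgf x
    simp [hr', i, hgf']

end Local

end LinearMap

namespace CochainComplex

variable {A : Type} [CommRing A] (C : CochainComplex (ModuleCat A) ℤ)

theorem isZero_homology_iff_exact {i j k : ℤ} (hij : i + 1 = j) (hjk : j + 1 = k) :
    IsZero (C.homology j) ↔ Function.Exact (C.d i j).hom (C.d j k).hom := by
  rw [← HomologicalComplex.exactAt_iff_isZero_homology,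
    C.exactAt_iff' i j k (ComplexShape.prev_eq' _ hij) (ComplexShape.next_eq' _ hjk)]
  exact ShortComplex.ShortExact.moduleCat_exact_iff_function_exact _

theorem exact_lTensor_of_isZero_homology (M : ModuleCat A) {i j k : ℤ} (hij : i + 1 = j)
    (hjk : j + 1 = k)
    (h : IsZero ((((tensorRight M).mapHomologicalComplex (ComplexShape.up ℤ)).obj C).homology j)) :
    Function.Exact ((C.d i j).hom.lTensor M) ((C.d j k).hom.lTensor M) := by
  have h' := (isZero_homology_iff_exact _ hij hjk).1 h
  have h'' : Function.Exact ((C.d i j).hom.rTensor M) ((C.d j k).hom.rTensor M) := h'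
  exact h''.of_ladder_linearEquiv_of_exact (e₁ := TensorProduct.comm A _ _)
    (e₂ := TensorProduct.comm A _ _) (e₃ := TensorProduct.comm A _ _)
    (TensorProduct.ext' fun _ _ ↦ rfl) (TensorProduct.ext' fun _ _ ↦ rfl)

end CochainComplex

/-- Let `(A, 𝔪)` be a commutative Noetherian local ring with residue field
`κ = A/𝔪`, and let `C` be a bounded complex of finitely generated free
`A`-modules such that the homology of `C ⊗_A κ` is concentrated in degree `0`.
Then the homology of `C` is concentrated in degree `0` and `H⁰(C)` is a
finitely generated free `A`-module. -/
theorem local_perfect_complex_degree_zero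
    (A : Type) [CommRing A] [IsNoetherianRing A] [IsLocalRing A]
    (C : CochainComplex (ModuleCat A) ℤ)
    (hfree : ∀ n : ℤ, Module.Free A (C.X n))
    (hfin : ∀ n : ℤ, Module.Finite A (C.X n))
    (hbdd : ∃ a b : ℤ, ∀ n : ℤ, (n < a ∨ b < n) → IsZero (C.X n))
    (hfiber : ∀ n : ℤ, n ≠ 0 →
      IsZero ((((tensorRight (ModuleCat.of A
        (IsLocalRing.ResidueField A))).mapHomologicalComplex
        (ComplexShape.up ℤ)).obj C).homology n)) :
    (∀ n : ℤ, n ≠ 0 → IsZero (C.homology n)) ∧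
      Module.Free A (C.homology 0) ∧ Module.Finite A (C.homology 0) := by
  obtain ⟨a, b, hab⟩ := hbdd
  have hcomp (i j k : ℤ) : (C.d j k).hom ∘ₗ (C.d i j).hom = 0 := by
    rw [← ModuleCat.hom_comp, C.d_comp_d, ModuleCat.hom_zero]
  have hex (n : ℤ) (hn : n ≠ 0) :=
    C.exact_lTensor_of_isZero_homology _ (sub_add_cancel n 1) rfl (hfiber n hn)
  have hsub (n : ℤ) (hn : n < a ∨ b < n) : Subsingleton (C.X n) :=
    ModuleCat.subsingleton_of_isZero (hab n hn)
  have hright (k : ℕ) : ∀ n : ℤ, 0 ≤ n → b < n + k → (C.d n (n + 1)).hom.IsRegular := by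
    induction k with
    | zero =>
      intro n _ hb
      have := hsub n (.inr (by simpa using hb))
      exact LinearMap.isRegular_of_subsingleton_left _
    | succ k ih =>
      intro n hn hb
      have hreg := ih (n + 1) (by lia) (by push_cast at hb; lia)
      have h := hex (n + 1) (by lia)
      rw [add_sub_cancel_right] at h
      exact hreg.of_exact_right (hreg.exact_of_exact_lTensor_residueField (hcomp _ _ _) h)
  have hleft (k : ℕ) : ∀ n : ℤ, n ≤ 0 → n - k < a → (C.d (n - 1) n).hom.IsRegular := by
    induction k with
    | zero =>
      intro n _ ha
      have := hsub n (.inl (by simpa using ha))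
      exact LinearMap.isRegular_of_subsingleton_right _
    | succ k ih =>
      intro n hn ha
      have hreg := ih (n - 1) (by lia) (by push_cast at ha; lia)
      have h := hex (n - 1) (by lia)
      rw [sub_add_cancel] at h
      exact (hreg.exact_and_isRegular_right (hcomp _ _ _) h).2
  have hright' (n : ℤ) (hn : 0 ≤ n) : (C.d n (n + 1)).hom.IsRegular :=
    hright (b + 1 - n).toNat n hn (by lia)
  have hleft' (n : ℤ) (hn : n ≤ 0) : (C.d (n - 1) n).hom.IsRegular :=
    hleft (n + 1 - a).toNat n hn (by lia)
  refine ⟨fun n hn ↦ ?_, ?_⟩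
  · rw [C.isZero_homology_iff_exact (sub_add_cancel n 1) rfl]
    rcases hn.lt_or_gt with h | h
    · exact ((hleft' n h.le).exact_and_isRegular_right (hcomp _ _ _) (hex n hn)).1
    · exact (hright' n h.le).exact_of_exact_lTensor_residueField (hcomp _ _ _) (hex n hn)
  · let S := C.sc' (0 - 1) 0 (0 + 1)
    let e : C.homology 0 ≅ S.moduleCatLeftHomologyData.H :=
      ShortComplex.homologyMapIso (C.isoSc' (0 - 1) 0 (0 + 1) (by simp) (by simp)) ≪≫
        S.moduleCatHomologyIso
    have : Module.Projective A S.moduleCatLeftHomologyData.H :=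
      (hleft' 0 le_rfl).projective_ker_quotient (hright' 0 le_rfl) _
    have : Module.Finite A S.moduleCatLeftHomologyData.H := by
      have : IsNoetherian A S.X₂ := inferInstanceAs (IsNoetherian A (C.X 0))
      exact inferInstanceAs (Module.Finite A
        (LinearMap.ker S.g.hom ⧸ LinearMap.range S.moduleCatToCycles))
    have : Module.Free A S.moduleCatLeftHomologyData.H := Module.free_of_flat_of_isLocalRing
    exact ⟨.of_equiv e.toLinearEquiv.symm, .equiv e.toLinearEquiv.symm⟩
end
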